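/- arXiv:2410.11991 — 8 statements merged into one kernel-verified Lean document; each statement's English description precedes it below -/
import Mathlib

section
/- Let (R,𝔪) be a reduced Noetherian local ring and let Min(R) = {P ∈ Spec(R) : dim R/P = dim R}. (1) Let ι : R → ∏_{P∈Min(R)} R/P be the natural ring map; then K₁ = ker(ι) and K₂ = coker(ι) are finitely generated R-modules with dim K₁ < dim R and dim K₂ < dim R. (2) There exists an R-linear map ι' : ∏_{P∈Min(R)} R/P → R such that K₃ = ker(ι') and K₄ = coker(ι') are finitely generated R-modules with dim K₃ < dim R and dim K₄ < dim R. -/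
open IsLocalRing

/-- `Min(R)`: the set of (minimal) primes `P` with `dim R/P = dim R`. -/
def MinDim (R : Type*) [CommRing R] : Set (Ideal R) :=
  {P | P.IsPrime ∧ ringKrullDim (R ⧸ P) = ringKrullDim R}

theorem exists_ringKrullDim_eq_natCast (R : Type*) [CommRing R] [FiniteRingKrullDim R] :
    ∃ n : ℕ, ringKrullDim R = n := by
  obtain ⟨m, hm⟩ := WithBot.ne_bot_iff_exists.mp (ringKrullDim_ne_bot (R := R))
  have htop := ringKrullDim_ne_top (R := R)
  rw [← hm] at htop ⊢
  obtain ⟨n, rfl⟩ := ENat.ne_top_iff_exists.mp (fun h : m = ⊤ => htop (by rw [h]; rfl))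
  exact ⟨n, rfl⟩

/-- A Noetherian local ring modulo an ideal contained in no prime of `MinDim R` has
dimension smaller than `dim R`. -/
theorem ringKrullDim_quotient_lt_of_forall_not_le {R : Type*} [CommRing R] [IsLocalRing R]
    [IsNoetherianRing R] (J : Ideal R) (hJ : ∀ P ∈ MinDim R, ¬ J ≤ P) :
    ringKrullDim (R ⧸ J) < ringKrullDim R := by
  by_contra! h
  obtain ⟨n, hn⟩ := exists_ringKrullDim_eq_natCast R
  have h' := h
  rw [hn, ringKrullDim_quotient, Order.le_krullDim_iff] at h'
  obtain ⟨l, hl⟩ := h'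
  refine hJ l.head.1.asIdeal ⟨l.head.1.isPrime,
    le_antisymm (ringKrullDim_quotient_le _) ?_⟩ l.head.2
  rw [hn, ringKrullDim_quotient, Order.le_krullDim_iff]
  exact ⟨⟨l.length, fun i => ⟨(l i).1, l.head_le i⟩, fun i => l.step i⟩, hl⟩

/-- Primes of maximal dimension in a Noetherian local ring are minimal. -/
theorem minDim_subset_minimalPrimes {R : Type*} [CommRing R] [IsLocalRing R]
    [IsNoetherianRing R] : MinDim R ⊆ minimalPrimes R := by
  intro P hP
  have := hP.1
  obtain ⟨Q, hQ, hQP⟩ := Ideal.exists_minimalPrimes_le (bot_le : ⊥ ≤ P)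
  have := hQ.1.1
  by_contra hPm
  have hlt : Q < P := lt_of_le_of_ne hQP (fun h => hPm (h ▸ hQ))
  obtain ⟨n, hn⟩ := exists_ringKrullDim_eq_natCast R
  have h := hP.2.ge
  rw [hn, ringKrullDim_quotient, Order.le_krullDim_iff] at h
  obtain ⟨l, hl⟩ := h
  let l' : LTSeries (PrimeSpectrum R) := l.map Subtype.val (fun _ _ h => h)
  have hlt' : (⟨Q, hQ.1.1⟩ : PrimeSpectrum R) < l'.head :=
    lt_of_lt_of_le (b := (⟨P, hP.1⟩ : PrimeSpectrum R)) hlt l.head.2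
  have hlen : ((n + 1 : ℕ) : WithBot ℕ∞) ≤ ringKrullDim R :=
    Order.le_krullDim_iff.mpr ⟨l'.cons _ hlt', by rw [RelSeries.cons_length, ← hl]; rfl⟩
  rw [hn] at hlen
  exact absurd (by exact_mod_cast hlen : n + 1 ≤ n) (by omega)

/-- In a reduced Noetherian ring, there is an element avoiding a given minimal prime `P` but
lying in all the others; it annihilates `P`. -/
theorem exists_notMem_mem_minimalPrimes {R : Type*} [CommRing R]
    [IsNoetherianRing R] {P : Ideal R} (hP : P ∈ minimalPrimes R) :
    ∃ a, a ∉ P ∧ ∀ Q ∈ minimalPrimes R, Q ≠ P → a ∈ Q := by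
  classical
  have := hP.1.1
  have hfin := minimalPrimes.finite_of_isNoetherianRing R
  have hle : ¬ (hfin.toFinset.erase P).inf id ≤ P := by
    rw [Ideal.IsPrime.inf_le' inferInstance]
    rintro ⟨Q, hQ, hQP⟩
    simp only [Finset.mem_erase, Set.Finite.mem_toFinset] at hQ
    exact hQ.1 (le_antisymm hQP (hP.2 hQ.2.1 hQP))
  obtain ⟨a, ha, haP⟩ := SetLike.not_le_iff_exists.mp hle
  refine ⟨a, haP, fun Q hQ hne => ?_⟩
  exact (Finset.inf_le (f := id) (by simpa using ⟨hne, hQ⟩ : Q ∈ hfin.toFinset.erase P)) ha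

theorem eq_zero_of_forall_mem_minimalPrimes {R : Type*} [CommRing R] [IsReduced R] {x : R}
    (hx : ∀ Q ∈ minimalPrimes R, x ∈ Q) : x = 0 := by
  have h : x ∈ sInf (minimalPrimes R) := Submodule.mem_sInf.mpr hx
  rw [minimalPrimes, Ideal.sInf_minimalPrimes] at h
  simpa using h


/-- An element outside `P` that kills `P` and lies in every other prime of `MinDim R`. -/
theorem exists_notMem_forall_mul_eq_zero {R : Type*} [CommRing R] [IsLocalRing R]
    [IsNoetherianRing R] [IsReduced R] (P : MinDim R) :
    ∃ a, a ∉ P.1 ∧ (∀ Q : MinDim R, Q ≠ P → a ∈ Q.1) ∧ ∀ x ∈ P.1, a * x = 0 := by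
  obtain ⟨a, haP, ha⟩ := exists_notMem_mem_minimalPrimes (minDim_subset_minimalPrimes P.2)
  refine ⟨a, haP, fun Q hQ => ha _ (minDim_subset_minimalPrimes Q.2)
    (fun h => hQ (Subtype.ext h)), fun x hx => eq_zero_of_forall_mem_minimalPrimes ?_⟩
  intro Q hQ
  by_cases h : Q = P.1
  · exact h ▸ P.1.mul_mem_left a hx
  · exact Q.mul_mem_right x (ha Q hQ h)

theorem ringKrullDim_quotient_annihilator_lt {R : Type*} [CommRing R] [IsLocalRing R]
    [IsNoetherianRing R] (M : Type*) [AddCommGroup M] [Module R M]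
    (h : ∀ P : MinDim R, ∃ a ∉ P.1, ∀ m : M, a • m = 0) :
    ringKrullDim (R ⧸ Module.annihilator R M) < ringKrullDim R := by
  refine ringKrullDim_quotient_lt_of_forall_not_le _ fun P hP hle => ?_
  obtain ⟨a, haP, ha⟩ := h ⟨P, hP⟩
  exact haP (hle (Module.mem_annihilator.mpr ha))

theorem stmt10 {R : Type*} [CommRing R] [IsLocalRing R] [IsNoetherianRing R] [IsReduced R] :
    -- (1) the natural map `ι : R → ∏_{P ∈ Min(R)} R/P` has finitely generated
    -- kernel and cokernel of dimension `< dim R`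
    (Module.Finite R (RingHom.ker (algebraMap R (∀ P : MinDim R, R ⧸ P.1))) ∧
      ringKrullDim (R ⧸ Module.annihilator R
        (RingHom.ker (algebraMap R (∀ P : MinDim R, R ⧸ P.1)))) < ringKrullDim R ∧
      Module.Finite R
        ((∀ P : MinDim R, R ⧸ P.1) ⧸
          LinearMap.range (Algebra.linearMap R (∀ P : MinDim R, R ⧸ P.1))) ∧
      ringKrullDim (R ⧸ Module.annihilator R
        ((∀ P : MinDim R, R ⧸ P.1) ⧸
          LinearMap.range (Algebra.linearMap R (∀ P : MinDim R, R ⧸ P.1)))) <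
        ringKrullDim R) ∧
    -- (2) there is an `R`-linear map `ι' : ∏_{P ∈ Min(R)} R/P → R` with finitely
    -- generated kernel and cokernel of dimension `< dim R`
    (∃ ι' : (∀ P : MinDim R, R ⧸ P.1) →ₗ[R] R,
      Module.Finite R (LinearMap.ker ι') ∧
      ringKrullDim (R ⧸ Module.annihilator R (LinearMap.ker ι')) < ringKrullDim R ∧
      Module.Finite R (R ⧸ LinearMap.range ι') ∧
      ringKrullDim (R ⧸ Module.annihilator R (R ⧸ LinearMap.range ι')) <
        ringKrullDim R) := by
  classical
  have : Finite (MinDim R) :=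
    ((minimalPrimes.finite_of_isNoetherianRing R).subset minDim_subset_minimalPrimes).to_subtype
  have := Fintype.ofFinite (MinDim R)
  choose a haP haQ ha0 using exists_notMem_forall_mul_eq_zero (R := R)
  refine ⟨⟨inferInstance, ringKrullDim_quotient_annihilator_lt _ fun P => ⟨a P, haP P, ?_⟩,
    inferInstance, ringKrullDim_quotient_annihilator_lt _ fun P => ⟨a P, haP P, ?_⟩⟩, ?_⟩
  · rintro ⟨x, hx⟩
    have hxP : x ∈ P.1 := Ideal.Quotient.eq_zero_iff_mem.mp (congrFun (RingHom.mem_ker.mp hx) P)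
    exact Subtype.ext (ha0 P x hxP)
  · intro m
    obtain ⟨y, rfl⟩ := Submodule.Quotient.mk_surjective _ m
    obtain ⟨r, hr⟩ := Ideal.Quotient.mk_surjective (y P)
    rw [← Submodule.Quotient.mk_smul, Submodule.Quotient.mk_eq_zero]
    refine ⟨a P * r, funext fun Q => ?_⟩
    change Ideal.Quotient.mk Q.1 (a P * r) = a P • y Q
    rw [Algebra.smul_def]
    change _ = Ideal.Quotient.mk Q.1 (a P) * y Q
    by_cases hQ : Q = P
    · subst hQ
      rw [map_mul, hr]
    · rw [map_mul, Ideal.Quotient.eq_zero_iff_mem.mpr (haQ P Q hQ), zero_mul, zero_mul]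
  · let f (P : MinDim R) : (R ⧸ P.1) →ₗ[R] R :=
      Submodule.liftQ P.1 (LinearMap.mulLeft R (a P)) (fun x hx => ha0 P x hx)
    let ι' : (∀ P : MinDim R, R ⧸ P.1) →ₗ[R] R := LinearMap.lsum R _ R f
    have hf (P : MinDim R) (r : R) : f P (Ideal.Quotient.mk P.1 r) = a P * r := rfl
    have hι (x) : ι' x = ∑ P, f P (x P) := by simp [ι', LinearMap.lsum_apply]
    refine ⟨ι', Module.Finite.of_injective (LinearMap.ker ι').subtype Subtype.val_injective,
      ringKrullDim_quotient_annihilator_lt _ fun P => ⟨a P, haP P, ?_⟩,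
      inferInstance, ringKrullDim_quotient_annihilator_lt _ fun P => ⟨a P, haP P, ?_⟩⟩
    · rintro ⟨x, hx⟩
      suffices x = 0 by subst this; exact Subtype.ext (smul_zero _)
      choose r hr using fun Q => Ideal.Quotient.mk_surjective (x Q)
      rw [LinearMap.mem_ker, hι] at hx
      simp only [← hr, hf] at hx
      funext Q
      rw [← hr, Pi.zero_apply, Ideal.Quotient.eq_zero_iff_mem]
      have hQ : a Q * r Q ∈ Q.1 := by
        rw [← Finset.add_sum_erase _ _ (Finset.mem_univ Q)] at hx
        rw [eq_neg_of_add_eq_zero_left hx]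
        exact Q.1.neg_mem (Q.1.sum_mem fun S hS =>
          Q.1.mul_mem_right _ (haQ S Q (Finset.ne_of_mem_erase hS).symm))
      exact (Q.2.1.mem_or_mem hQ).resolve_left (haP Q)
    · intro m
      obtain ⟨r, rfl⟩ := Submodule.Quotient.mk_surjective _ m
      rw [← Submodule.Quotient.mk_smul, Submodule.Quotient.mk_eq_zero]
      refine ⟨Pi.single P (Ideal.Quotient.mk P.1 r), ?_⟩
      rw [hι, Finset.sum_eq_single P _ (by simp), Pi.single_eq_same, hf, smul_eq_mul]
      intro Q _ hQ
      rw [Pi.single_eq_of_ne hQ, map_zero]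
end

section
/- Let C ⊆ ℝ^d be a full-dimensional closed convex cone that is pointed at the direction of some nonzero vector a ∈ ℝ^d. Then there exists a vector b ∈ ℝ^d such that C is upward to the direction of b, i.e. there exist constants 0 < c₁ < c₂ < ‖b‖ with {x : ⟨x,b⟩ ≥ c₂‖x‖} ⊆ C ⊆ {x : ⟨x,b⟩ ≥ c₁‖x‖}. -/
open RealInnerProductSpace

/-- `C` is a convex cone: `α₁·C + α₂·C ⊆ C` for all `α₁, α₂ ≥ 0`. -/
def IsConvCone {d : ℕ} (C : Set (EuclideanSpace ℝ (Fin d))) : Prop :=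
  ∀ a b : ℝ, 0 ≤ a → 0 ≤ b → ∀ x ∈ C, ∀ y ∈ C, a • x + b • y ∈ C

/-- Moving a point `a` to its projection onto a closed convex cone does not decrease its inner
product with the elements of the cone. -/
theorem IsConvCone.exists_mem_inner_le {d : ℕ} {C : Set (EuclideanSpace ℝ (Fin d))}
    (hcone : IsConvCone C) (hclosed : IsClosed C) (hne : C.Nonempty)
    (a : EuclideanSpace ℝ (Fin d)) : ∃ p ∈ C, ∀ x ∈ C, ⟪x, a⟫ ≤ ⟪x, p⟫ := by
  have hconv : Convex ℝ C := fun x hx y hy s t hs ht _ => hcone s t hs ht x hx y hy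
  obtain ⟨p, hp, hmin⟩ := exists_norm_eq_iInf_of_complete_convex hne hclosed.isComplete hconv a
  refine ⟨p, hp, fun x hx => ?_⟩
  have hpx : p + x ∈ C := by simpa using hcone 1 1 zero_le_one zero_le_one p hp x hx
  have h := (norm_eq_iInf_iff_real_inner_le_zero hconv hp).1 hmin (p + x) hpx
  rw [add_sub_cancel_left, real_inner_comm, inner_sub_right] at h
  linarith

/-- A convex cone contains a circular cone around each of its nonzero interior points. -/
theorem IsConvCone.exists_circular_subset {d : ℕ} {C : Set (EuclideanSpace ℝ (Fin d))}
    (hcone : IsConvCone C) {b : EuclideanSpace ℝ (Fin d)} (hb : b ∈ interior C) (hb0 : b ≠ 0)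
    {c : ℝ} (hc : c < ‖b‖) :
    ∃ c₂ : ℝ, c < c₂ ∧ c₂ < ‖b‖ ∧ {x | c₂ * ‖x‖ ≤ ⟪x, b⟫} ⊆ C := by
  have hbpos : 0 < ‖b‖ := norm_pos_iff.2 hb0
  obtain ⟨r, hr, hball⟩ := Metric.isOpen_iff.1 isOpen_interior b hb
  have hlt : max c (‖b‖ - r ^ 2 / (2 * ‖b‖)) < ‖b‖ :=
    max_lt hc (sub_lt_self _ (by positivity))
  obtain ⟨c₂, h₁, h₂⟩ := exists_between hlt
  obtain ⟨hcc, hrc⟩ := max_lt_iff.1 h₁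
  refine ⟨c₂, hcc, h₂, fun x (hx : c₂ * ‖x‖ ≤ ⟪x, b⟫) => ?_⟩
  rcases eq_or_ne x 0 with rfl | hx0
  · simpa using hcone 0 0 le_rfl le_rfl b (interior_subset hb) b (interior_subset hb)
  have hxpos : 0 < ‖x‖ := norm_pos_iff.2 hx0
  set s : ℝ := ‖b‖ / ‖x‖ with hs
  have hspos : 0 < s := by positivity
  have hsx : s * ‖x‖ = ‖b‖ := div_mul_cancel₀ _ hxpos.ne'
  have hinner : ‖b‖ * c₂ ≤ s * ⟪x, b⟫ := by
    have := mul_le_mul_of_nonneg_left hx hspos.le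
    rw [← hsx]
    linarith
  have hgap : 2 * ‖b‖ * (‖b‖ - c₂) < r ^ 2 := by
    have : ‖b‖ - c₂ < r ^ 2 / (2 * ‖b‖) := by linarith
    rw [lt_div_iff₀ (by positivity)] at this
    linarith
  have hnorm : ‖s • x - b‖ ^ 2 < r ^ 2 := by
    rw [norm_sub_sq_real, norm_smul, Real.norm_of_nonneg hspos.le, hsx, real_inner_smul_left]
    linarith
  have hmem : s • x ∈ C := interior_subset <| hball <| by
    rw [Metric.mem_ball, dist_eq_norm]
    exact lt_of_pow_lt_pow_left₀ 2 hr.le hnorm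
  have := hcone s⁻¹ 0 (by positivity) le_rfl _ hmem _ hmem
  rwa [zero_smul, add_zero, inv_smul_smul₀ hspos.ne'] at this

theorem stmt12 {d : ℕ} (C : Set (EuclideanSpace ℝ (Fin d)))
    (hcone : IsConvCone C) (hclosed : IsClosed C)
    (hfull : (interior C).Nonempty)
    (a : EuclideanSpace ℝ (Fin d)) (ha : a ≠ 0)
    (hpointed : ∃ c₁ : ℝ, 0 < c₁ ∧ c₁ < ‖a‖ ∧
      C ⊆ {x | c₁ * ‖x‖ ≤ ⟪x, a⟫}) :
    ∃ (b : EuclideanSpace ℝ (Fin d)) (c₁ c₂ : ℝ),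
      0 < c₁ ∧ c₁ < c₂ ∧ c₂ < ‖b‖ ∧
      {x | c₂ * ‖x‖ ≤ ⟪x, b⟫} ⊆ C ∧
      C ⊆ {x | c₁ * ‖x‖ ≤ ⟪x, b⟫} := by
  obtain ⟨c, hc, -, hsub⟩ := hpointed
  obtain ⟨u, hu⟩ := hfull
  obtain ⟨p, hp, hpa⟩ := hcone.exists_mem_inner_le hclosed ⟨u, interior_subset hu⟩ a
  have hconv : Convex ℝ C := fun x hx y hy s t hs ht _ => hcone s t hs ht x hx y hy
  -- `b` is a point of the segment from `p` to `u`, close to `p`.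
  have hlim : Filter.Tendsto (fun t : ℝ => ‖t • (u - p)‖) (nhdsWithin 0 (Set.Ioi 0)) (nhds 0) := by
    have : Continuous fun t : ℝ => ‖t • (u - p)‖ := by fun_prop
    simpa using (this.tendsto 0).mono_left nhdsWithin_le_nhds
  obtain ⟨t, ht, ht0, ht1⟩ := ((hlim.eventually_lt_const (half_pos hc)).and
    (Ioo_mem_nhdsGT (zero_lt_one' ℝ))).exists
  set b := p + t • (u - p) with hbdef
  have hb : b ∈ interior C := hconv.add_smul_sub_mem_interior hp hu ⟨ht0, ht1.le⟩
  have hlow : ∀ x ∈ C, c / 2 * ‖x‖ ≤ ⟪x, b⟫ := fun x hx => by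
    have h₁ : c * ‖x‖ ≤ ⟪x, a⟫ := hsub hx
    have h₂ := hpa x hx
    have h₃ := (abs_le.1 (abs_real_inner_le_norm x (t • (u - p)))).1
    have h₄ := mul_le_mul_of_nonneg_left ht.le (norm_nonneg x)
    rw [hbdef, inner_add_right]
    linarith
  have hb0 : b ≠ 0 := fun h0 => by
    have hC : C ⊆ {0} := fun x hx => by
      have := hlow x hx
      rw [h0, inner_zero_right] at this
      exact norm_le_zero_iff.1 (nonpos_of_mul_nonpos_right this (half_pos hc))
    have : Nontrivial (EuclideanSpace ℝ (Fin d)) := ⟨a, 0, ha⟩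
    have := Module.punctured_nhds_neBot ℝ (EuclideanSpace ℝ (Fin d)) 0
    simpa using interior_mono hC hb
  have hbpos : 0 < ‖b‖ := norm_pos_iff.2 hb0
  have hcb : c / 2 ≤ ‖b‖ := by
    have := hlow b (interior_subset hb)
    rw [real_inner_self_eq_norm_mul_norm] at this
    exact le_of_mul_le_mul_right this hbpos
  obtain ⟨c₂, h₁, h₂, h₃⟩ := hcone.exists_circular_subset hb hb0 (c := c / 4) (by linarith)
  refine ⟨b, c / 4, c₂, by positivity, h₁, h₂, h₃, fun x hx => ?_⟩
  have := hlow x hx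
  have := mul_nonneg hc.le (norm_nonneg x)
  show c / 4 * ‖x‖ ≤ ⟪x, b⟫
  linarith
end

section
/- Let C ⊆ ℝ^d be a convex cone upward to the direction of a nonzero vector b, let Δ ⊆ C be a C°-ideal containing a nonzero element, and let H = {x ∈ ℝ^d : ⟨x,b⟩ = 0}. Then for every x ∈ H there exists a unique real number φ(x) ≥ 0 such that x + t·b ∈ Δ for all t > φ(x) and x + t·b ∉ Δ for all t < φ(x). -/
open RealInnerProductSpace

/-- `C` is upward to the direction of `b`: there are `0 < c₁ < c₂ < ‖b‖` with
`{x : ⟨x,b⟩ ≥ c₂‖x‖} ⊆ C ⊆ {x : ⟨x,b⟩ ≥ c₁‖x‖}`. -/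
def IsUpward {d : ℕ} (C : Set (EuclideanSpace ℝ (Fin d)))
    (b : EuclideanSpace ℝ (Fin d)) : Prop :=
  ∃ c₁ c₂ : ℝ, 0 < c₁ ∧ c₁ < c₂ ∧ c₂ < ‖b‖ ∧
    {x | c₂ * ‖x‖ ≤ ⟪x, b⟫} ⊆ C ∧ C ⊆ {x | c₁ * ‖x‖ ≤ ⟪x, b⟫}

/-- `Δ` is a `C°`-ideal: `C° + Δ ⊆ Δ`. -/
def IsIntIdeal {d : ℕ} (C Δ : Set (EuclideanSpace ℝ (Fin d))) : Prop :=
  Δ ⊆ C ∧ ∀ u ∈ interior C, ∀ v ∈ Δ, u + v ∈ Δ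

/-- `φ` is the height function of `Δ` (relative to the direction `b`):
for each `x` in the hyperplane `H = {x : ⟨x,b⟩ = 0}`, `φ x ≥ 0`,
`x + t·b ∈ Δ` for `t > φ x`, and `x + t·b ∉ Δ` for `t < φ x`. -/
def IsHeightFun {d : ℕ} (Δ : Set (EuclideanSpace ℝ (Fin d)))
    (b : EuclideanSpace ℝ (Fin d)) (φ : EuclideanSpace ℝ (Fin d) → ℝ) : Prop :=
  ∀ x : EuclideanSpace ℝ (Fin d), ⟪x, b⟫ = 0 →
    0 ≤ φ x ∧ (∀ t : ℝ, φ x < t → x + t • b ∈ Δ) ∧ (∀ t : ℝ, t < φ x → x + t • b ∉ Δ)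

/-- The open cone `{y : c‖y‖ < ⟨y,b⟩}` lies in the interior of any set containing its closed
counterpart. -/
theorem mem_interior_of_lt_inner {d : ℕ} {C : Set (EuclideanSpace ℝ (Fin d))}
    {b y : EuclideanSpace ℝ (Fin d)} {c : ℝ} (hC : {x | c * ‖x‖ ≤ ⟪x, b⟫} ⊆ C)
    (hy : c * ‖y‖ < ⟪y, b⟫) : y ∈ interior C := by
  have hopen : IsOpen {x : EuclideanSpace ℝ (Fin d) | c * ‖x‖ < ⟪x, b⟫} :=
    isOpen_lt (by fun_prop) (by fun_prop)
  have hsub : {x : EuclideanSpace ℝ (Fin d) | c * ‖x‖ < ⟪x, b⟫} ⊆ C :=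
    fun x (hx : c * ‖x‖ < ⟪x, b⟫) => hC hx.le
  exact interior_maximal hsub hopen hy

/-- A nonempty upper set of reals that is bounded below by `0` has a unique threshold. -/
theorem existsUnique_threshold {S : Set ℝ} (hup : IsUpperSet S) (hne : S.Nonempty)
    (h0 : ∀ t ∈ S, 0 ≤ t) :
    ∃! φ : ℝ, 0 ≤ φ ∧ (∀ t : ℝ, φ < t → t ∈ S) ∧ (∀ t : ℝ, t < φ → t ∉ S) := by
  refine ⟨sInf S, ⟨le_csInf hne h0, fun t ht => ?_, fun t ht hS => ?_⟩, ?_⟩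
  · obtain ⟨s, hs, hst⟩ := exists_lt_of_csInf_lt hne ht
    exact hup hst.le hs
  · exact absurd (csInf_le ⟨0, h0⟩ hS) (not_le.mpr ht)
  · rintro ψ ⟨-, h₁, h₂⟩
    refine le_antisymm (le_csInf hne fun t ht => not_lt.mp fun h => h₂ t h ht) ?_
    exact le_of_forall_gt_imp_ge_of_dense fun t ht => csInf_le ⟨0, h0⟩ (h₁ t ht)

theorem stmt13 {d : ℕ} (C : Set (EuclideanSpace ℝ (Fin d)))
    (hcone : IsConvCone C)
    (b : EuclideanSpace ℝ (Fin d)) (hb : b ≠ 0) (hup : IsUpward C b)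
    (Δ : Set (EuclideanSpace ℝ (Fin d))) (hΔ : IsIntIdeal C Δ)
    (hne : ∃ z ∈ Δ, z ≠ 0) :
    ∀ x : EuclideanSpace ℝ (Fin d), ⟪x, b⟫ = 0 →
      ∃! φ : ℝ, 0 ≤ φ ∧ (∀ t : ℝ, φ < t → x + t • b ∈ Δ) ∧
        (∀ t : ℝ, t < φ → x + t • b ∉ Δ) := by
  intro x hx
  obtain ⟨c₁, c₂, hc₁, hc₁₂, hc₂, hC₂, hC₁⟩ := hup
  obtain ⟨hΔC, hideal⟩ := hΔ
  obtain ⟨z, hz, -⟩ := hne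
  have hbpos : 0 < ‖b‖ := norm_pos_iff.mpr hb
  have hgap : 0 < ‖b‖ * (‖b‖ - c₂) := mul_pos hbpos (sub_pos.mpr hc₂)
  refine existsUnique_threshold (S := {t : ℝ | x + t • b ∈ Δ}) ?_ ?_ ?_
  · intro s t hst hs
    rcases hst.eq_or_lt with rfl | hlt
    · exact hs
    have hpos : 0 < t - s := sub_pos.mpr hlt
    have hmem : (t - s) • b ∈ interior C := by
      refine mem_interior_of_lt_inner hC₂ ?_
      rw [norm_smul, real_inner_smul_left, real_inner_self_eq_norm_sq, Real.norm_of_nonneg hpos.le]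
      nlinarith [mul_pos hpos hgap]
    have h := hideal _ hmem _ hs
    rwa [show (t - s) • b + (x + s • b) = x + t • b by module] at h
  · obtain ⟨t, ht⟩ := exists_gt (max 0 ((c₂ * ‖x - z‖ + ⟪z, b⟫) / (‖b‖ * (‖b‖ - c₂))))
    obtain ⟨ht0, ht⟩ := max_lt_iff.mp ht
    rw [div_lt_iff₀ hgap] at ht
    have hmem : (x - z) + t • b ∈ interior C := by
      refine mem_interior_of_lt_inner hC₂ ?_
      have hnorm : ‖(x - z) + t • b‖ ≤ ‖x - z‖ + t * ‖b‖ := by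
        simpa [norm_smul, abs_of_pos ht0] using norm_add_le (x - z) (t • b)
      rw [inner_add_left, inner_sub_left, hx, real_inner_smul_left, real_inner_self_eq_norm_sq]
      nlinarith [mul_le_mul_of_nonneg_left hnorm (hc₁.trans hc₁₂).le]
    have h := hideal _ hmem _ hz
    rw [show (x - z) + t • b + z = x + t • b by module] at h
    exact ⟨t, h⟩
  · intro t ht
    have h : c₁ * ‖x + t • b‖ ≤ ⟪x + t • b, b⟫ := hC₁ (hΔC ht)
    rw [inner_add_left, hx, real_inner_smul_left, real_inner_self_eq_norm_sq, zero_add] at h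
    exact nonneg_of_mul_nonneg_left ((by positivity : 0 ≤ c₁ * ‖x + t • b‖).trans h)
      (by positivity)
end

section
/- Let C ⊆ ℝ^d be a convex cone upward to the direction of a nonzero vector b, let H = {x : ⟨x,b⟩ = 0}, and suppose 0 < c₂ < ‖b‖ satisfies {x : ⟨x,b⟩ ≥ c₂‖x‖} ⊆ C° ∪ {0}. Then, with φ_C and φ_{C°} the height functions of the C°-ideals C and C° respectively, one has 0 ≤ φ_C(y) ≤ φ_{C°}(y) ≤ c₃‖y‖ for all y ∈ H, where one may take c₃ = c₂/√(‖b‖⁴ − c₂²‖b‖²). -/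
open RealInnerProductSpace

/-- Points at height more than `c / √(‖b‖⁴ - c²‖b‖²) * ‖y‖` above a point `y` orthogonal to `b`
lie in the round cone `{x : ⟨x,b⟩ ≥ c‖x‖}`. -/
theorem norm_add_smul_cone_bound {E : Type*} [NormedAddCommGroup E] [InnerProductSpace ℝ E]
    {b y : E} {c t : ℝ} (hc : 0 < c) (hcb : c < ‖b‖) (hy : ⟪y, b⟫ = 0)
    (ht : c / Real.sqrt (‖b‖ ^ 4 - c ^ 2 * ‖b‖ ^ 2) * ‖y‖ < t) :
    c * ‖y + t • b‖ ≤ ⟪y + t • b, b⟫ := by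
  have ht0 : 0 < t := lt_of_le_of_lt (by positivity) ht
  have hD : 0 < ‖b‖ ^ 4 - c ^ 2 * ‖b‖ ^ 2 := by
    have hsq : c ^ 2 < ‖b‖ ^ 2 := pow_lt_pow_left₀ hcb hc.le two_ne_zero
    nlinarith [pow_pos (hc.trans hcb) 2]
  have hnorm : ‖y + t • b‖ ^ 2 = ‖y‖ ^ 2 + t ^ 2 * ‖b‖ ^ 2 := by
    rw [norm_add_sq_real, real_inner_smul_right, hy, norm_smul, mul_pow, Real.norm_eq_abs, sq_abs]
    ring
  have hle : c * ‖y‖ ≤ t * Real.sqrt (‖b‖ ^ 4 - c ^ 2 * ‖b‖ ^ 2) := by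
    rw [div_mul_eq_mul_div, div_lt_iff₀ (Real.sqrt_pos.mpr hD)] at ht
    exact ht.le
  have hsq := pow_le_pow_left₀ (by positivity) hle 2
  rw [mul_pow, mul_pow, Real.sq_sqrt hD.le] at hsq
  rw [inner_add_left, hy, real_inner_smul_left, real_inner_self_eq_norm_sq, zero_add]
  refine (sq_le_sq₀ (by positivity) (by positivity)).mp ?_
  rw [mul_pow, hnorm]
  linarith

theorem stmt14 {d : ℕ} (C : Set (EuclideanSpace ℝ (Fin d)))
    (hcone : IsConvCone C)
    (b : EuclideanSpace ℝ (Fin d)) (hb : b ≠ 0) (hup : IsUpward C b)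
    (c₂ : ℝ) (hc₂0 : 0 < c₂) (hc₂b : c₂ < ‖b‖)
    (hcirc : {x : EuclideanSpace ℝ (Fin d) | c₂ * ‖x‖ ≤ ⟪x, b⟫} ⊆ interior C ∪ {0})
    (φC φI : EuclideanSpace ℝ (Fin d) → ℝ)
    (hφC : IsHeightFun C b φC) (hφI : IsHeightFun (interior C) b φI) :
    ∀ y : EuclideanSpace ℝ (Fin d), ⟪y, b⟫ = 0 →
      0 ≤ φC y ∧ φC y ≤ φI y ∧
      φI y ≤ c₂ / Real.sqrt (‖b‖ ^ 4 - c₂ ^ 2 * ‖b‖ ^ 2) * ‖y‖ := by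
  intro y hy
  obtain ⟨hC0, -, hCnotMem⟩ := hφC y hy
  obtain ⟨-, hImem, hInotMem⟩ := hφI y hy
  refine ⟨hC0, le_of_forall_gt_imp_ge_of_dense fun t ht => ?_,
    le_of_forall_gt_imp_ge_of_dense fun t ht => ?_⟩
  · exact not_lt.mp fun h => hCnotMem t h (interior_subset (hImem t ht))
  · refine not_lt.mp fun h => hInotMem t h ?_
    have ht0 : 0 < t := lt_of_le_of_lt (by positivity) ht
    have hbpos : 0 < ‖b‖ := norm_pos_iff.mpr hb
    have hinner : ⟪y + t • b, b⟫ = t * ‖b‖ ^ 2 := by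
      rw [inner_add_left, hy, real_inner_smul_left, real_inner_self_eq_norm_sq, zero_add]
    have hpos : 0 < ⟪y + t • b, b⟫ := by rw [hinner]; positivity
    refine (hcirc ?_).resolve_right fun h0 => ?_
    · exact norm_add_smul_cone_bound hc₂0 hc₂b hy ht
    · rw [Set.mem_singleton_iff] at h0
      simp [h0] at hpos
end

section
/- Let C ⊆ ℝ^d be a convex cone upward to the direction of a nonzero vector b and H = {x : ⟨x,b⟩ = 0}. A function φ : H → ℝ is the height function of some C°-ideal in C if and only if it satisfies: (1) φ(x) ≥ φ_C(x) for all x ∈ H, and (2) φ(x) + φ_{C°}(y) ≥ φ(x+y) for all x,y ∈ H. -/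
open RealInnerProductSpace

/-- The decomposition `x + t • b` with `x` orthogonal to `b ≠ 0` is unique. -/
lemma add_smul_inj_of_inner_eq_zero {E : Type*} [NormedAddCommGroup E] [InnerProductSpace ℝ E]
    {b x y : E} {s t : ℝ} (hb : b ≠ 0) (hx : ⟪x, b⟫ = 0) (hy : ⟪y, b⟫ = 0)
    (h : x + s • b = y + t • b) : x = y ∧ s = t := by
  have hst : s = t := by
    have h' := congrArg (fun z => ⟪z, b⟫) h
    simp only [inner_add_left, real_inner_smul_left, hx, hy, zero_add] at h'
    exact mul_right_cancel₀ (inner_self_ne_zero.mpr hb) h'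
  subst hst
  exact ⟨add_right_cancel h, rfl⟩

/-- Every vector is `x + t • b` with `x` orthogonal to `b ≠ 0`. -/
lemma exists_add_smul_of_inner_eq_zero {E : Type*} [NormedAddCommGroup E] [InnerProductSpace ℝ E]
    {b : E} (hb : b ≠ 0) (z : E) : ∃ x : E, ∃ t : ℝ, ⟪x, b⟫ = 0 ∧ z = x + t • b := by
  refine ⟨z - (⟪z, b⟫ / ⟪b, b⟫) • b, ⟪z, b⟫ / ⟪b, b⟫, ?_, by simp⟩
  rw [inner_sub_left, real_inner_smul_left, div_mul_cancel₀ _ (inner_self_ne_zero.mpr hb), sub_self]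

theorem stmt15 {d : ℕ} (C : Set (EuclideanSpace ℝ (Fin d)))
    (hcone : IsConvCone C)
    (b : EuclideanSpace ℝ (Fin d)) (hb : b ≠ 0) (hup : IsUpward C b)
    (φC φI : EuclideanSpace ℝ (Fin d) → ℝ)
    (hφC : IsHeightFun C b φC) (hφI : IsHeightFun (interior C) b φI)
    (φ : EuclideanSpace ℝ (Fin d) → ℝ) :
    (∃ Δ : Set (EuclideanSpace ℝ (Fin d)), IsIntIdeal C Δ ∧ IsHeightFun Δ b φ) ↔
      ((∀ x : EuclideanSpace ℝ (Fin d), ⟪x, b⟫ = 0 → φC x ≤ φ x) ∧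
        (∀ x y : EuclideanSpace ℝ (Fin d), ⟪x, b⟫ = 0 → ⟪y, b⟫ = 0 →
          φ (x + y) ≤ φ x + φI y)) := by
  constructor
  · rintro ⟨Δ, ⟨hΔC, hΔ⟩, hφ⟩
    refine ⟨fun x hx => ?_, fun x y hx hy => ?_⟩
    · by_contra! hlt
      obtain ⟨t, ht, ht'⟩ := exists_between hlt
      exact (hφC x hx).2.2 t ht' (hΔC ((hφ x hx).2.1 t ht))
    · by_contra! hlt
      obtain ⟨s, hs, hs'⟩ := exists_between (lt_sub_iff_add_lt.mpr hlt)
      have hxy : ⟪x + y, b⟫ = 0 := by rw [inner_add_left, hx, hy, add_zero]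
      obtain ⟨r, hr, hr'⟩ := exists_between (lt_sub_comm.mp hs')
      refine (hφ _ hxy).2.2 (r + s) (lt_sub_iff_add_lt.mp hr') ?_
      convert hΔ _ ((hφI y hy).2.1 r hr) _ ((hφ x hx).2.1 s hs) using 1
      module
  · rintro ⟨hC, hI⟩
    refine ⟨{z | ∃ x : EuclideanSpace ℝ (Fin d), ∃ t : ℝ, ⟪x, b⟫ = 0 ∧ φ x < t ∧ z = x + t • b},
      ⟨?_, ?_⟩, fun x hx => ⟨(hφC x hx).1.trans (hC x hx), fun t ht => ⟨x, t, hx, ht, rfl⟩, ?_⟩⟩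
    · rintro _ ⟨x, t, hx, ht, rfl⟩
      exact (hφC x hx).2.1 t ((hC x hx).trans_lt ht)
    · rintro u hu _ ⟨x, t, hx, ht, rfl⟩
      obtain ⟨y, r, hy, rfl⟩ := exists_add_smul_of_inner_eq_zero hb u
      have hr : φI y ≤ r := not_lt.mp fun h => (hφI y hy).2.2 r h hu
      refine ⟨x + y, t + r, by rw [inner_add_left, hx, hy, add_zero], ?_, by module⟩
      exact (hI x y hx hy).trans_lt (add_lt_add_of_lt_of_le ht hr)
    · rintro t ht ⟨y, s, hy, hs, h⟩
      obtain ⟨rfl, rfl⟩ := add_smul_inj_of_inner_eq_zero hb hx hy h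
      exact lt_asymm ht hs
end

section
/- Let C ⊆ ℝ^d be a convex cone upward to the direction of a nonzero vector b, H = {x : ⟨x,b⟩ = 0}, and let Δ be a C°-ideal in C containing a nonzero element. Assume for some 0 < c₂ < ‖b‖ the circular cone {x : ⟨x,b⟩ ≥ c₂‖x‖} lies in C°. Then there exists a constant c₃ > 0 such that |φ_Δ(x) − φ_Δ(y)| ≤ c₃‖x − y‖ for all x,y ∈ H, i.e. the height function φ_Δ is Lipschitz continuous. -/
open RealInnerProductSpace

/-- A height function grows at a bounded rate along `H`: the upward cone with its vertex at a point
of `Δ` stays inside `Δ`. -/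
theorem IsHeightFun.le_add {d : ℕ} {C Δ : Set (EuclideanSpace ℝ (Fin d))}
    {b : EuclideanSpace ℝ (Fin d)} (hb : b ≠ 0) (hΔ : IsIntIdeal C Δ)
    {c : ℝ} (hc0 : 0 < c) (hcb : c < ‖b‖)
    (hcirc : {x : EuclideanSpace ℝ (Fin d) | c * ‖x‖ ≤ ⟪x, b⟫} ⊆ interior C ∪ {0})
    {φ : EuclideanSpace ℝ (Fin d) → ℝ} (hφ : IsHeightFun Δ b φ)
    {x y : EuclideanSpace ℝ (Fin d)} (hx : ⟪x, b⟫ = 0) (hy : ⟪y, b⟫ = 0) :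
    φ x ≤ φ y + c / (‖b‖ * (‖b‖ - c)) * ‖x - y‖ := by
  rcases eq_or_ne x y with rfl | hxy
  · simp
  have hbpos : 0 < ‖b‖ := norm_pos_iff.mpr hb
  have hgap : 0 < ‖b‖ - c := sub_pos.mpr hcb
  have hnorm : 0 < ‖x - y‖ := norm_pos_iff.mpr (sub_ne_zero.mpr hxy)
  set s := c / (‖b‖ * (‖b‖ - c)) * ‖x - y‖ with hs
  have hspos : 0 < s := by positivity
  have hseq : s * (‖b‖ * (‖b‖ - c)) = c * ‖x - y‖ := by
    rw [hs]; field_simp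
  have hinner : ⟪(x - y) + s • b, b⟫ = s * ‖b‖ ^ 2 := by
    rw [inner_add_left, inner_sub_left, hx, hy, real_inner_smul_left,
      real_inner_self_eq_norm_sq]
    ring
  have hle : ‖(x - y) + s • b‖ ≤ ‖x - y‖ + s * ‖b‖ := by
    refine (norm_add_le _ _).trans_eq ?_
    rw [norm_smul, Real.norm_of_nonneg hspos.le]
  have hint : (x - y) + s • b ∈ interior C := by
    refine (hcirc ?_).resolve_right fun h0 => ?_
    · rw [Set.mem_ofPred_eq, hinner]
      linarith [mul_le_mul_of_nonneg_left hle hc0.le]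
    · rw [Set.mem_singleton_iff.mp h0, inner_zero_left] at hinner
      have : 0 < s * ‖b‖ ^ 2 := by positivity
      linarith
  refine le_of_forall_gt_imp_ge_of_dense fun r hr => ?_
  by_contra! hlt
  refine (hφ x hx).2.2 r hlt ?_
  have hmem := hΔ.2 _ hint _ ((hφ y hy).2.1 (r - s) (by linarith))
  convert hmem using 1
  module

theorem stmt16 {d : ℕ} (C : Set (EuclideanSpace ℝ (Fin d)))
    (hcone : IsConvCone C)
    (b : EuclideanSpace ℝ (Fin d)) (hb : b ≠ 0) (hup : IsUpward C b)
    (Δ : Set (EuclideanSpace ℝ (Fin d))) (hΔ : IsIntIdeal C Δ)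
    (hne : ∃ z ∈ Δ, z ≠ 0)
    (c₂ : ℝ) (hc₂0 : 0 < c₂) (hc₂b : c₂ < ‖b‖)
    (hcirc : {x : EuclideanSpace ℝ (Fin d) | c₂ * ‖x‖ ≤ ⟪x, b⟫} ⊆ interior C ∪ {0})
    (φ : EuclideanSpace ℝ (Fin d) → ℝ) (hφ : IsHeightFun Δ b φ) :
    ∃ c₃ : ℝ, 0 < c₃ ∧ ∀ x y : EuclideanSpace ℝ (Fin d),
      ⟪x, b⟫ = 0 → ⟪y, b⟫ = 0 → |φ x - φ y| ≤ c₃ * ‖x - y‖ := by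
  have hgap : 0 < ‖b‖ - c₂ := sub_pos.mpr hc₂b
  have hbpos : 0 < ‖b‖ := norm_pos_iff.mpr hb
  refine ⟨c₂ / (‖b‖ * (‖b‖ - c₂)), by positivity, fun x y hx hy => ?_⟩
  have hxy := hφ.le_add hb hΔ hc₂0 hc₂b hcirc hx hy
  have hyx := hφ.le_add hb hΔ hc₂0 hc₂b hcirc hy hx
  rw [norm_sub_rev y x] at hyx
  exact abs_sub_le_iff.mpr ⟨by linarith, by linarith⟩
end

section
/- Let C ⊆ ℝ^d be a convex cone upward to the direction of a nonzero vector b, H = {x : ⟨x,b⟩ = 0}, and let Δ be a C°-ideal in C containing a nonzero element, with height function φ_Δ. Then: (1) the interior of Δ is {x + t·b : x ∈ H, t > φ_Δ(x)}; (2) the closure of Δ is {x + t·b : x ∈ H, t ≥ φ_Δ(x)}; (3) the frontier of Δ is {x + φ_Δ(x)·b : x ∈ H}, and this set has Lebesgue measure zero in ℝ^d. -/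
open RealInnerProductSpace

section Sublevel

variable {E : Type*} [NormedAddCommGroup E] [NormedSpace ℝ E] {h : E → ℝ} {b : E} {s : Set E}

theorem interior_eq_of_sublevel (hc : Continuous h) (hb : ∀ z t, h (z + t • b) = h z - t)
    (hlt : {z | h z < 0} ⊆ s) (hle : s ⊆ {z | h z ≤ 0}) : interior s = {z | h z < 0} := by
  refine subset_antisymm (fun z hz => ?_)
    (interior_maximal hlt (isOpen_lt hc continuous_const))
  have hcont : Continuous fun t : ℝ => z + t • b := by fun_prop
  have hnhds : ∀ᶠ t in nhds (0 : ℝ), z + t • b ∈ s :=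
    hcont.continuousAt.eventually_mem (by simpa using mem_interior_iff_mem_nhds.1 hz)
  obtain ⟨ε, hε, hball⟩ := Metric.eventually_nhds_iff.1 hnhds
  have hmem : z + (-(ε / 2)) • b ∈ s := hball (by
    rw [Real.dist_eq, sub_zero, abs_neg, abs_of_pos (by positivity)]
    linarith)
  have hz0 := hle hmem
  simp only [Set.mem_ofPred_eq, hb] at hz0 ⊢
  linarith

theorem closure_eq_of_sublevel (hc : Continuous h) (hb : ∀ z t, h (z + t • b) = h z - t)
    (hlt : {z | h z < 0} ⊆ s) (hle : s ⊆ {z | h z ≤ 0}) : closure s = {z | h z ≤ 0} := by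
  refine subset_antisymm (closure_minimal hle (isClosed_le hc continuous_const)) fun z hz => ?_
  have hcont : Continuous fun t : ℝ => z + t • b := by fun_prop
  have ht : Filter.Tendsto (fun t : ℝ => z + t • b) (nhdsWithin 0 (Set.Ioi 0)) (nhds z) := by
    simpa using (hcont.tendsto 0).mono_left nhdsWithin_le_nhds
  refine mem_closure_of_tendsto ht ?_
  filter_upwards [self_mem_nhdsWithin] with t htpos
  refine hlt ?_
  simp only [Set.mem_ofPred_eq, Set.mem_Ioi, hb] at hz htpos ⊢
  linarith

theorem addHaar_zero_level [MeasurableSpace E] [BorelSpace E] [FiniteDimensional ℝ E]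
    (μ : MeasureTheory.Measure E) [μ.IsAddHaarMeasure] (hc : Continuous h)
    (hb : ∀ z t, h (z + t • b) = h z - t) : μ {z | h z = 0} = 0 := by
  refine MeasureTheory.Measure.addHaar_eq_zero_of_disjoint_translates μ
    (u := fun n : ℕ => (1 / ((n : ℝ) + 1)) • b) ?_ ?_
    (isClosed_eq hc continuous_const).measurableSet
  · have ht := (tendsto_one_div_add_atTop_nhds_zero_nat (𝕜 := ℝ)).smul_const b
    exact Metric.isBounded_range_of_tendsto _ ht
  · intro m n hmn
    refine Set.disjoint_left.2 fun z hm hn => hmn ?_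
    simp only [Set.singleton_add, Set.mem_image, Set.mem_ofPred_eq] at hm hn
    obtain ⟨x, hx, rfl⟩ := hm
    obtain ⟨y, hy, hxy⟩ := hn
    have heq := congrArg h hxy
    rw [add_comm _ y, add_comm _ x, hb, hb, hx, hy] at heq
    have h1 : (1 / ((n : ℝ) + 1)) = 1 / ((m : ℝ) + 1) := by linarith
    rw [one_div, one_div, inv_inj] at h1
    exact_mod_cast (add_right_cancel h1).symm

end Sublevel

theorem IsUpward.exists_mem_interior {d : ℕ} {C : Set (EuclideanSpace ℝ (Fin d))}
    {b : EuclideanSpace ℝ (Fin d)} (hup : IsUpward C b) :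
    ∃ K : ℝ, 0 ≤ K ∧ ∀ x t, ⟪x, b⟫ = (0 : ℝ) → K * ‖x‖ < t → x + t • b ∈ interior C := by
  obtain ⟨c₁, c₂, hc₁, hc₁₂, hc₂, hsub, -⟩ := hup
  have hc₂pos : 0 < c₂ := hc₁.trans hc₁₂
  have hbpos : 0 < ‖b‖ := hc₂pos.trans hc₂
  have hden : 0 < ‖b‖ * (‖b‖ - c₂) := mul_pos hbpos (sub_pos.2 hc₂)
  refine ⟨c₂ / (‖b‖ * (‖b‖ - c₂)), by positivity, fun x t hx ht => ?_⟩
  have hopen : IsOpen {x : EuclideanSpace ℝ (Fin d) | c₂ * ‖x‖ < ⟪x, b⟫} :=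
    isOpen_lt (by fun_prop) (by fun_prop)
  refine interior_maximal (subset_trans (fun z hz => le_of_lt (Set.mem_ofPred_eq ▸ hz)) hsub)
    hopen ?_
  have htpos : 0 < t := lt_of_le_of_lt (by positivity) ht
  have hnorm : ‖x + t • b‖ ≤ ‖x‖ + t * ‖b‖ := by
    simpa [norm_smul, abs_of_pos htpos] using norm_add_le x (t • b)
  have hinner : ⟪x + t • b, b⟫ = t * ‖b‖ ^ 2 := by
    rw [inner_add_left, hx, real_inner_smul_left, real_inner_self_eq_norm_sq, zero_add]
  rw [div_mul_eq_mul_div, div_lt_iff₀ hden] at ht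
  have hmul := mul_le_mul_of_nonneg_left hnorm hc₂pos.le
  simp only [Set.mem_ofPred_eq, hinner]
  nlinarith

theorem IsHeightFun.exists_le_add {d : ℕ} {C Δ : Set (EuclideanSpace ℝ (Fin d))}
    {b : EuclideanSpace ℝ (Fin d)} {φ : EuclideanSpace ℝ (Fin d) → ℝ}
    (hφ : IsHeightFun Δ b φ) (hup : IsUpward C b) (hΔ : IsIntIdeal C Δ) :
    ∃ K : ℝ, 0 ≤ K ∧ ∀ x y, ⟪x, b⟫ = (0 : ℝ) → ⟪y, b⟫ = (0 : ℝ) →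
      φ y ≤ φ x + K * ‖y - x‖ := by
  obtain ⟨K, hK, hKC⟩ := hup.exists_mem_interior
  refine ⟨K, hK, fun x y hx hy => le_of_forall_pos_lt_add fun ε hε => ?_⟩
  have hyx : ⟪y - x, b⟫ = (0 : ℝ) := by rw [inner_sub_left, hx, hy, sub_zero]
  have hv := (hφ x hx).2.1 (φ x + ε / 3) (by linarith)
  have hu := hKC (y - x) (K * ‖y - x‖ + ε / 3) hyx (by linarith)
  have hsum := hΔ.2 _ hu _ hv
  have heq : y - x + (K * ‖y - x‖ + ε / 3) • b + (x + (φ x + ε / 3) • b)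
      = y + (φ x + K * ‖y - x‖ + 2 * (ε / 3)) • b := by module
  rw [heq] at hsum
  have hle := not_lt.1 fun hlt => (hφ y hy).2.2 _ hlt hsum
  linarith

/-- The height of the boundary of `Δ` above `z`, measured along `b`. -/
noncomputable def heightGap {d : ℕ} (b : EuclideanSpace ℝ (Fin d))
    (φ : EuclideanSpace ℝ (Fin d) → ℝ) (z : EuclideanSpace ℝ (Fin d)) : ℝ :=
  φ (z - (⟪z, b⟫ / ‖b‖ ^ 2) • b) - ⟪z, b⟫ / ‖b‖ ^ 2

section HeightGap

variable {d : ℕ} {b : EuclideanSpace ℝ (Fin d)} {φ : EuclideanSpace ℝ (Fin d) → ℝ}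

theorem inner_sub_div_smul_self (hb : b ≠ 0) (z : EuclideanSpace ℝ (Fin d)) :
    ⟪z - (⟪z, b⟫ / ‖b‖ ^ 2) • b, b⟫ = (0 : ℝ) := by
  have : ‖b‖ ≠ 0 := norm_ne_zero_iff.2 hb
  rw [inner_sub_left, real_inner_smul_left, real_inner_self_eq_norm_sq]
  field_simp
  ring

theorem heightGap_add_smul (hb : b ≠ 0) (z : EuclideanSpace ℝ (Fin d)) (t : ℝ) :
    heightGap b φ (z + t • b) = heightGap b φ z - t := by
  have hb' : ‖b‖ ≠ 0 := norm_ne_zero_iff.2 hb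
  have hs : ⟪z + t • b, b⟫ / ‖b‖ ^ 2 = ⟪z, b⟫ / ‖b‖ ^ 2 + t := by
    rw [inner_add_left, real_inner_smul_left, real_inner_self_eq_norm_sq]
    field_simp
  have hp : z + t • b - (⟪z, b⟫ / ‖b‖ ^ 2 + t) • b = z - (⟪z, b⟫ / ‖b‖ ^ 2) • b := by module
  rw [heightGap, heightGap, hs, hp]
  ring

theorem heightGap_of_inner_eq_zero {x : EuclideanSpace ℝ (Fin d)} (hx : ⟪x, b⟫ = (0 : ℝ)) :
    heightGap b φ x = φ x := by
  simp [heightGap, hx]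

theorem exists_iff_heightGap (hb : b ≠ 0) (P : ℝ → Prop) (z : EuclideanSpace ℝ (Fin d)) :
    (∃ x t, ⟪x, b⟫ = (0 : ℝ) ∧ P (φ x - t) ∧ z = x + t • b) ↔ P (heightGap b φ z) := by
  constructor
  · rintro ⟨x, t, hx, hP, rfl⟩
    rwa [heightGap_add_smul hb, heightGap_of_inner_eq_zero hx]
  · intro hP
    exact ⟨_, _, inner_sub_div_smul_self hb z, hP, (sub_add_cancel _ _).symm⟩

theorem continuous_heightGap {C Δ : Set (EuclideanSpace ℝ (Fin d))} (hb : b ≠ 0)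
    (hφ : IsHeightFun Δ b φ) (hup : IsUpward C b) (hΔ : IsIntIdeal C Δ) :
    Continuous (heightGap b φ) := by
  obtain ⟨K, hK, hle⟩ := hφ.exists_le_add hup hΔ
  have hφc : ContinuousOn φ {x | ⟪x, b⟫ = (0 : ℝ)} :=
    (LipschitzOnWith.of_le_add_mul ⟨K, hK⟩ fun x hx y hy => by
      rw [dist_eq_norm]; exact hle y x hy hx).continuousOn
  have hs : Continuous fun z : EuclideanSpace ℝ (Fin d) => ⟪z, b⟫ / ‖b‖ ^ 2 :=
    (continuous_id.inner continuous_const).div_const _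
  exact (hφc.comp_continuous (continuous_id.sub (hs.smul continuous_const))
    (inner_sub_div_smul_self hb)).sub hs

end HeightGap

open MeasureTheory in
theorem stmt17 {d : ℕ} (C : Set (EuclideanSpace ℝ (Fin d)))
    (hcone : IsConvCone C)
    (b : EuclideanSpace ℝ (Fin d)) (hb : b ≠ 0) (hup : IsUpward C b)
    (Δ : Set (EuclideanSpace ℝ (Fin d))) (hΔ : IsIntIdeal C Δ)
    (hne : ∃ z ∈ Δ, z ≠ 0)
    (φ : EuclideanSpace ℝ (Fin d) → ℝ) (hφ : IsHeightFun Δ b φ) :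
    interior Δ = {z | ∃ x t, ⟪x, b⟫ = (0 : ℝ) ∧ φ x < t ∧ z = x + t • b} ∧
    closure Δ = {z | ∃ x t, ⟪x, b⟫ = (0 : ℝ) ∧ φ x ≤ t ∧ z = x + t • b} ∧
    frontier Δ = {z | ∃ x, ⟪x, b⟫ = (0 : ℝ) ∧ z = x + φ x • b} ∧
    volume {z : EuclideanSpace ℝ (Fin d) | ∃ x, ⟪x, b⟫ = (0 : ℝ) ∧ z = x + φ x • b} = 0 := by
  have hc := continuous_heightGap hb hφ hup hΔ
  have hadd := heightGap_add_smul (φ := φ) hb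
  have hltset : {z | ∃ x t, ⟪x, b⟫ = (0 : ℝ) ∧ φ x < t ∧ z = x + t • b}
      = {z | heightGap b φ z < 0} := by
    ext z
    simpa only [sub_neg, Set.mem_ofPred_eq] using exists_iff_heightGap (φ := φ) hb (· < 0) z
  have hleset : {z | ∃ x t, ⟪x, b⟫ = (0 : ℝ) ∧ φ x ≤ t ∧ z = x + t • b}
      = {z | heightGap b φ z ≤ 0} := by
    ext z
    simpa only [sub_nonpos, Set.mem_ofPred_eq] using exists_iff_heightGap (φ := φ) hb (· ≤ 0) z
  have heqset : {z | ∃ x, ⟪x, b⟫ = (0 : ℝ) ∧ z = x + φ x • b} = {z | heightGap b φ z = 0} := by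
    ext z
    refine Iff.trans ?_ (exists_iff_heightGap (φ := φ) hb (· = 0) z)
    constructor
    · rintro ⟨x, hx, rfl⟩
      exact ⟨x, _, hx, sub_self _, rfl⟩
    · rintro ⟨x, t, hx, ht, rfl⟩
      exact ⟨x, hx, by rw [sub_eq_zero.1 ht]⟩
  have hlt : {z | heightGap b φ z < 0} ⊆ Δ := by
    rw [← hltset]
    rintro _ ⟨x, t, hx, ht, rfl⟩
    exact (hφ x hx).2.1 t ht
  have hle : Δ ⊆ {z | heightGap b φ z ≤ 0} := by
    intro z hz
    by_contra hpos
    obtain ⟨x, t, hx, ht, rfl⟩ := (exists_iff_heightGap (φ := φ) hb (0 < ·) z).2 (not_le.1 hpos)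
    exact (hφ x hx).2.2 t (sub_pos.1 ht) hz
  have hint := interior_eq_of_sublevel hc hadd hlt hle
  have hcl := closure_eq_of_sublevel hc hadd hlt hle
  rw [hltset, hleset, heqset]
  refine ⟨hint, hcl, ?_, addHaar_zero_level volume hc hadd⟩
  rw [frontier, hint, hcl]
  ext z
  simp [le_antisymm_iff]
end

section
/- Let C ⊆ ℝ^d be a convex cone upward to the direction of a nonzero vector b and let Δ₁ ⊆ Δ₂ be two C°-ideals in C, each containing a nonzero element, with height functions φ_{Δ₁}, φ_{Δ₂} on H = {x : ⟨x,b⟩ = 0}. Then: (1) φ_{Δ₁}(x) ≥ φ_{Δ₂}(x) for all x ∈ H; (2) if φ_{Δ₁} = φ_{Δ₂} on all of H, then Δ₁ and Δ₂ have the same interior and the same closure; (3) if φ_{Δ₁}(x) ≠ φ_{Δ₂}(x) for some x ∈ H, then the interior of Δ₂ is not contained in the closure of Δ₁. -/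
open RealInnerProductSpace

/-- Positive multiples of `b` are interior points of a set that is upward to the direction of `b`. -/
theorem IsUpward.smul_mem_interior {d : ℕ} {C : Set (EuclideanSpace ℝ (Fin d))}
    {b : EuclideanSpace ℝ (Fin d)} (hb : b ≠ 0) (hup : IsUpward C b) {t : ℝ} (ht : 0 < t) :
    t • b ∈ interior C := by
  obtain ⟨c₁, c₂, -, -, h₂, hC, -⟩ := hup
  have hbpos : 0 < ‖b‖ := norm_pos_iff.mpr hb
  have hopen : IsOpen {x : EuclideanSpace ℝ (Fin d) | c₂ * ‖x‖ < ⟪x, b⟫} :=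
    isOpen_lt (by fun_prop) (by fun_prop)
  refine interior_maximal (fun x (hx : c₂ * ‖x‖ < ⟪x, b⟫) => hC hx.le) hopen ?_
  change c₂ * ‖t • b‖ < ⟪t • b, b⟫
  rw [norm_smul, real_inner_smul_left, real_inner_self_eq_norm_sq, Real.norm_of_nonneg ht.le]
  nlinarith [mul_lt_mul_of_pos_right h₂ (mul_pos ht hbpos)]

theorem exists_orthogonal_add_smul {d : ℕ} {b : EuclideanSpace ℝ (Fin d)} (hb : b ≠ 0)
    (y : EuclideanSpace ℝ (Fin d)) :
    ∃ x : EuclideanSpace ℝ (Fin d), ∃ t : ℝ, ⟪x, b⟫ = 0 ∧ y = x + t • b := by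
  have hbb : ⟪b, b⟫ ≠ 0 := inner_self_ne_zero.mpr hb
  refine ⟨y - (⟪y, b⟫ / ⟪b, b⟫) • b, ⟪y, b⟫ / ⟪b, b⟫, ?_, by abel⟩
  rw [inner_sub_left, real_inner_smul_left, div_mul_cancel₀ _ hbb, sub_self]

theorem IsHeightFun.le_of_mem {d : ℕ} {Δ : Set (EuclideanSpace ℝ (Fin d))}
    {b : EuclideanSpace ℝ (Fin d)} {φ : EuclideanSpace ℝ (Fin d) → ℝ} (hφ : IsHeightFun Δ b φ)
    {x : EuclideanSpace ℝ (Fin d)} (hx : ⟪x, b⟫ = 0) {t : ℝ} (h : x + t • b ∈ Δ) : φ x ≤ t :=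
  not_lt.mp fun hlt => (hφ x hx).2.2 t hlt h

/-- The height function of a subset dominates the height function of the larger set. -/
theorem IsHeightFun.anti {d : ℕ} {Δ₁ Δ₂ : Set (EuclideanSpace ℝ (Fin d))}
    {b : EuclideanSpace ℝ (Fin d)} {φ₁ φ₂ : EuclideanSpace ℝ (Fin d) → ℝ}
    (hφ₁ : IsHeightFun Δ₁ b φ₁) (hφ₂ : IsHeightFun Δ₂ b φ₂) (h12 : Δ₁ ⊆ Δ₂)
    {x : EuclideanSpace ℝ (Fin d)} (hx : ⟪x, b⟫ = 0) : φ₂ x ≤ φ₁ x :=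
  le_of_forall_gt_imp_ge_of_dense fun t ht => hφ₂.le_of_mem hx (h12 ((hφ₁ x hx).2.1 t ht))

/-- The interior of a set is contained in any set whose height function is no larger. -/
theorem IsHeightFun.interior_subset {d : ℕ} {Δ₁ Δ₂ : Set (EuclideanSpace ℝ (Fin d))}
    {b : EuclideanSpace ℝ (Fin d)} {φ₁ φ₂ : EuclideanSpace ℝ (Fin d) → ℝ} (hb : b ≠ 0)
    (hφ₁ : IsHeightFun Δ₁ b φ₁) (hφ₂ : IsHeightFun Δ₂ b φ₂)
    (h : ∀ x : EuclideanSpace ℝ (Fin d), ⟪x, b⟫ = 0 → φ₁ x ≤ φ₂ x) :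
    interior Δ₂ ⊆ Δ₁ := by
  intro y hy
  obtain ⟨x, t, hx, rfl⟩ := exists_orthogonal_add_smul hb y
  have hcont : Filter.Tendsto (fun s : ℝ => x + s • b) (nhdsWithin t (Set.Iio t))
      (nhds (x + t • b)) :=
    (Continuous.tendsto (by fun_prop) t).mono_left nhdsWithin_le_nhds
  obtain ⟨s, hs, hst⟩ := ((hcont.eventually (mem_interior_iff_mem_nhds.mp hy)).and
    self_mem_nhdsWithin).exists
  exact (hφ₁ x hx).2.1 t (((h x hx).trans (hφ₂.le_of_mem hx hs)).trans_lt hst)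

/-- A set is contained in the closure of any set whose height function is no larger. -/
theorem IsHeightFun.subset_closure {d : ℕ} {Δ₁ Δ₂ : Set (EuclideanSpace ℝ (Fin d))}
    {b : EuclideanSpace ℝ (Fin d)} {φ₁ φ₂ : EuclideanSpace ℝ (Fin d) → ℝ} (hb : b ≠ 0)
    (hφ₁ : IsHeightFun Δ₁ b φ₁) (hφ₂ : IsHeightFun Δ₂ b φ₂)
    (h : ∀ x : EuclideanSpace ℝ (Fin d), ⟪x, b⟫ = 0 → φ₁ x ≤ φ₂ x) :
    Δ₂ ⊆ closure Δ₁ := by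
  intro y hy
  obtain ⟨x, t, hx, rfl⟩ := exists_orthogonal_add_smul hb y
  have hcont : Filter.Tendsto (fun s : ℝ => x + s • b) (nhdsWithin t (Set.Ioi t))
      (nhds (x + t • b)) :=
    (Continuous.tendsto (by fun_prop) t).mono_left nhdsWithin_le_nhds
  refine mem_closure_of_tendsto hcont ?_
  filter_upwards [self_mem_nhdsWithin] with s hs
  exact (hφ₁ x hx).2.1 s (((h x hx).trans (hφ₂.le_of_mem hx hy)).trans_lt hs)

theorem IsIntIdeal.add_mem_interior {d : ℕ} {C Δ : Set (EuclideanSpace ℝ (Fin d))}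
    (hΔ : IsIntIdeal C Δ) {u v : EuclideanSpace ℝ (Fin d)} (hu : u ∈ interior C) (hv : v ∈ Δ) :
    u + v ∈ interior Δ := by
  have hopen : IsOpen ((fun y => y - v) ⁻¹' interior C) :=
    isOpen_interior.preimage (by fun_prop)
  refine interior_maximal (fun y hy => ?_) hopen (by simpa using hu)
  simpa using hΔ.2 _ hy v hv

theorem IsIntIdeal.add_mem_of_mem_closure {d : ℕ} {C Δ : Set (EuclideanSpace ℝ (Fin d))}
    (hΔ : IsIntIdeal C Δ) {u v : EuclideanSpace ℝ (Fin d)} (hu : u ∈ interior C)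
    (hv : v ∈ closure Δ) : u + v ∈ Δ := by
  have hopen : IsOpen ((fun y => u + v - y) ⁻¹' interior C) :=
    isOpen_interior.preimage (by fun_prop)
  obtain ⟨y, hy, hyΔ⟩ := mem_closure_iff.mp hv _ hopen (by simpa using hu)
  simpa using hΔ.2 _ hy y hyΔ

theorem stmt18 {d : ℕ} (C : Set (EuclideanSpace ℝ (Fin d)))
    (hcone : IsConvCone C)
    (b : EuclideanSpace ℝ (Fin d)) (hb : b ≠ 0) (hup : IsUpward C b)
    (Δ₁ Δ₂ : Set (EuclideanSpace ℝ (Fin d)))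
    (hΔ₁ : IsIntIdeal C Δ₁) (hΔ₂ : IsIntIdeal C Δ₂) (h12 : Δ₁ ⊆ Δ₂)
    (hne₁ : ∃ z ∈ Δ₁, z ≠ 0) (hne₂ : ∃ z ∈ Δ₂, z ≠ 0)
    (φ₁ φ₂ : EuclideanSpace ℝ (Fin d) → ℝ)
    (hφ₁ : IsHeightFun Δ₁ b φ₁) (hφ₂ : IsHeightFun Δ₂ b φ₂) :
    -- (1)
    (∀ x : EuclideanSpace ℝ (Fin d), ⟪x, b⟫ = 0 → φ₂ x ≤ φ₁ x) ∧
    -- (2)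
    ((∀ x : EuclideanSpace ℝ (Fin d), ⟪x, b⟫ = 0 → φ₁ x = φ₂ x) →
      interior Δ₁ = interior Δ₂ ∧ closure Δ₁ = closure Δ₂) ∧
    -- (3)
    ((∃ x : EuclideanSpace ℝ (Fin d), ⟪x, b⟫ = 0 ∧ φ₁ x ≠ φ₂ x) →
      ¬ interior Δ₂ ⊆ closure Δ₁) := by
  refine ⟨fun x hx => hφ₁.anti hφ₂ h12 hx, fun h => ⟨?_, ?_⟩, ?_⟩
  · exact (interior_mono h12).antisymm (interior_maximal
      (hφ₁.interior_subset hb hφ₂ fun x hx => (h x hx).le) isOpen_interior)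
  · exact (closure_mono h12).antisymm (closure_minimal
      (hφ₁.subset_closure hb hφ₂ fun x hx => (h x hx).le) isClosed_closure)
  · rintro ⟨x, hx, hne⟩ hsub
    obtain ⟨t, h₂t, ht₁⟩ := exists_between ((hφ₁.anti hφ₂ h12 hx).lt_of_ne' hne)
    obtain ⟨s, h₂s, hst⟩ := exists_between h₂t
    obtain ⟨r, htr, hr₁⟩ := exists_between ht₁
    have hmem : (t - s) • b + (x + s • b) ∈ interior Δ₂ :=
      hΔ₂.add_mem_interior (hup.smul_mem_interior hb (sub_pos.mpr hst)) ((hφ₂ x hx).2.1 s h₂s)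
    have hmem' := hΔ₁.add_mem_of_mem_closure
      (hup.smul_mem_interior hb (sub_pos.mpr htr)) (hsub hmem)
    refine (hφ₁ x hx).2.2 r hr₁ ?_
    convert hmem' using 1
    module
end
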